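/- Let ε ~ N(0, σ² I_n), y = μ + ε for fixed μ ∈ ℝⁿ, and let μ̂ : ℝⁿ → ℝⁿ be a smooth compactly supported estimator. Define SURE = ‖y - μ̂(y)‖² + 2σ² div μ̂(y) - σ² n. Then E[(SURE - ‖μ̂(y) - μ‖²)²] = E[4σ² ‖y - μ̂(y)‖² + 4σ⁴ tr((∇μ̂(y))²) - 2σ⁴ n]. -/

import Mathlib

open MeasureTheory ProbabilityTheory

lemma htg_fderiv {E F : Type*} [NormedAddCommGroup E] [NormedSpace ℝ E]
    [NormedAddCommGroup F] [NormedSpace ℝ F] {f : E → F}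
    (hf : f.HasTemperateGrowth) : (fderiv ℝ f).HasTemperateGrowth := by
  refine ⟨hf.1.fderiv_right (by norm_cast), fun n => ?_⟩
  obtain ⟨k, C, h⟩ := hf.2 (n + 1)
  refine ⟨k, C, fun x => ?_⟩
  have h' := h x
  rw [← norm_iteratedFDeriv_fderiv] at h'
  exact h'

/-- partial derivative -/
noncomputable def pd {n : ℕ} (i : Fin n) (h : (Fin n → ℝ) → ℝ) : (Fin n → ℝ) → ℝ :=
  fun y => fderiv ℝ h y (Pi.single i 1)

section
variable {n : ℕ}

@[fun_prop]
lemma htg_pd (i : Fin n) {h : (Fin n → ℝ) → ℝ} (hh : h.HasTemperateGrowth) :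
    (pd i h).HasTemperateGrowth :=
  (ContinuousLinearMap.apply ℝ ℝ (Pi.single i (1:ℝ) : Fin n → ℝ)).hasTemperateGrowth.comp
    (htg_fderiv hh)

@[fun_prop]
lemma htg_coord (i : Fin n) : (fun y : Fin n → ℝ => y i).HasTemperateGrowth :=
  (ContinuousLinearMap.proj (R := ℝ) (φ := fun _ : Fin n => ℝ) i).hasTemperateGrowth

lemma htg_diff {h : (Fin n → ℝ) → ℝ} (hh : h.HasTemperateGrowth) : Differentiable ℝ h :=
  hh.1.differentiable (by simp)

lemma pd_mul (i : Fin n) {f g : (Fin n → ℝ) → ℝ} (hf : f.HasTemperateGrowth)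
    (hg : g.HasTemperateGrowth) (y) :
    pd i (fun y => f y * g y) y = pd i f y * g y + f y * pd i g y := by
  unfold pd
  rw [fderiv_fun_mul (htg_diff hf y) (htg_diff hg y)]
  simp; ring

lemma pd_sub (i : Fin n) {f g : (Fin n → ℝ) → ℝ} (hf : f.HasTemperateGrowth)
    (hg : g.HasTemperateGrowth) (y) :
    pd i (fun y => f y - g y) y = pd i f y - pd i g y := by
  unfold pd
  rw [fderiv_fun_sub (htg_diff hf y) (htg_diff hg y)]
  simp

lemma pd_sum (i : Fin n) {f : Fin n → (Fin n → ℝ) → ℝ} (hf : ∀ j, (f j).HasTemperateGrowth) (y) :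
    pd i (fun y => ∑ j, f j y) y = ∑ j, pd i (f j) y := by
  unfold pd
  rw [fderiv_fun_sum (fun j _ => htg_diff (hf j) y)]
  simp

lemma pd_const_mul (i : Fin n) (c : ℝ) {f : (Fin n → ℝ) → ℝ} (hf : f.HasTemperateGrowth) (y) :
    pd i (fun y => c * f y) y = c * pd i f y := by
  unfold pd
  rw [fderiv_const_mul (htg_diff hf y)]
  simp

lemma pd_coord (i j : Fin n) (c : ℝ) (y : Fin n → ℝ) :
    pd i (fun y => y j - c) y = if i = j then 1 else 0 := by
  unfold pd
  have : HasFDerivAt (fun y : Fin n → ℝ => y j - c)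
    (ContinuousLinearMap.proj (R := ℝ) (φ := fun _ : Fin n => ℝ) j) y :=
    (ContinuousLinearMap.proj (R := ℝ) (φ := fun _ : Fin n => ℝ) j).hasFDerivAt.sub_const c
  rw [this.fderiv]
  simp [Pi.single_apply, eq_comm]

lemma pd_comm (i j : Fin n) {f : (Fin n → ℝ) → ℝ} (hf : f.HasTemperateGrowth) (y) :
    pd i (pd j f) y = pd j (pd i f) y := by
  have key : ∀ a b : Fin n, pd a (pd b f) y =
      fderiv ℝ (fderiv ℝ f) y (Pi.single a 1) (Pi.single b 1) := by
    intro a b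
    have h1 : DifferentiableAt ℝ (fderiv ℝ f) y :=
      (htg_fderiv hf).1.differentiable (by simp) y
    show fderiv ℝ (fun y => fderiv ℝ f y (Pi.single b 1)) y (Pi.single a 1) = _
    rw [fderiv_clm_apply h1 (differentiableAt_const _)]
    simp
  rw [key, key]
  have := (hf.1.contDiffAt (x := y)).isSymmSndFDerivAt (by simp only [minSmoothness_of_isRCLikeNormedField]; exact WithTop.coe_le_coe.2 (le_top : (2:ℕ∞) ≤ ⊤))
  exact this _ _

/-- the law of y -/
noncomputable def nu (σ : NNReal) (m : Fin n → ℝ) : Measure (Fin n → ℝ) :=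
  Measure.pi fun i : Fin n => gaussianReal (m i) (σ ^ 2)

instance (σ : NNReal) (m : Fin n → ℝ) : IsProbabilityMeasure (nu σ m) := by
  unfold nu; infer_instance

lemma htg_int (σ : NNReal) (m : Fin n → ℝ) {h : (Fin n → ℝ) → ℝ} (hh : h.HasTemperateGrowth) :
    Integrable h (nu σ m) := by
  obtain ⟨k, C, hC⟩ := hh.2 0
  have hi : Integrable (fun y : Fin n → ℝ => |C| * ∏ i, (1 + |y i|) ^ k) (nu σ m) := by
    refine Integrable.const_mul ?_ _
    refine Integrable.fintype_prod (f := fun i (x : ℝ) => (1 + |x|) ^ k) fun i => ?_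
    have h1 : MemLp (fun x : ℝ => 1 + |x|) k (gaussianReal (m i) (σ ^ 2)) :=
      by
      have h0 : MemLp (fun x : ℝ => |x|) k (gaussianReal (m i) (σ ^ 2)) :=
        (memLp_id_gaussianReal' (μ := m i) (v := σ ^ 2) (k : ENNReal) (ENNReal.natCast_ne_top k)).norm
      have h00 : MemLp (fun _ : ℝ => (1:ℝ)) k (gaussianReal (m i) (σ ^ 2)) := memLp_const 1
      exact h00.add h0
    have := h1.integrable_norm_pow'
    refine this.congr (ae_of_all _ fun x => ?_)
    simp only [Real.norm_eq_abs]
    rw [abs_of_nonneg (by positivity)]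
  refine hi.mono' hh.1.continuous.aestronglyMeasurable (ae_of_all _ fun y => ?_)
  have h1 := hC y
  rw [norm_iteratedFDeriv_zero] at h1
  refine h1.trans ?_
  have h2 : 1 + ‖y‖ ≤ ∏ i, (1 + |y i|) := by
    have hp : ∀ i, 1 ≤ 1 + |y i| := fun i => by simp
    have hp0 : ∀ s : Finset (Fin n), 1 ≤ ∏ i ∈ s, (1 + |y i|) := fun s =>
      Finset.prod_induction _ (fun x : ℝ => 1 ≤ x)
        (fun _ _ => one_le_mul_of_one_le_of_one_le) le_rfl fun i _ => hp i
    have hp1 := hp0 Finset.univ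
    have : ‖y‖ ≤ ∏ i, (1 + |y i|) - 1 := by
      refine (pi_norm_le_iff_of_nonneg (by linarith)).2 fun i => ?_
      have h3 := Finset.mul_prod_erase Finset.univ (fun i => 1 + |y i|) (Finset.mem_univ i)
      have h4 := hp0 (Finset.univ.erase i)
      rw [Real.norm_eq_abs]
      nlinarith [hp i]
    linarith
  rw [Finset.prod_pow]
  gcongr
  exact le_abs_self C

lemma nu_density {σ : NNReal} (hσ : σ ≠ 0) (m : Fin n → ℝ) :
    nu σ m = (volume : Measure (Fin n → ℝ)).withDensity
      (fun y => ENNReal.ofReal (∏ i, gaussianPDFReal (m i) (σ ^ 2) (y i))) := by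
  have hv : σ ^ 2 ≠ 0 := by positivity
  unfold nu
  refine (Measure.pi_eq fun s hs => ?_)
  rw [withDensity_apply _ (MeasurableSet.univ_pi hs), volume_pi, Measure.restrict_pi_pi,
    ← ofReal_integral_eq_lintegral_ofReal]
  · rw [integral_fintype_prod_eq_prod (f := fun i x => gaussianPDFReal (m i) (σ ^ 2) x),
      ENNReal.ofReal_prod_of_nonneg]
    · refine Finset.prod_congr rfl fun i _ => ?_
      rw [gaussianReal_apply_eq_integral _ hv]
    · exact fun i _ => integral_nonneg fun x => gaussianPDFReal_nonneg _ _ _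
  · exact Integrable.fintype_prod (f := fun i x => gaussianPDFReal (m i) (σ ^ 2) x)
      fun i => (integrable_gaussianPDFReal _ _).restrict
  · exact ae_of_all _ fun y => Finset.prod_nonneg fun i _ => gaussianPDFReal_nonneg _ _ _

lemma meas_dens (σ : NNReal) (m : Fin n → ℝ) :
    Measurable (fun y : Fin n → ℝ => ENNReal.ofReal (∏ i, gaussianPDFReal (m i) (σ ^ 2) (y i))) := by
  refine ENNReal.measurable_ofReal.comp (Finset.measurable_prod _ fun i _ => ?_)
  exact (measurable_gaussianPDFReal _ _).comp (measurable_pi_apply i)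

lemma dens_nonneg (σ : NNReal) (m : Fin n → ℝ) (y : Fin n → ℝ) :
   0 ≤ ∏ i, gaussianPDFReal (m i) (σ ^ 2) (y i) :=
  Finset.prod_nonneg fun i _ => gaussianPDFReal_nonneg _ _ _

lemma nu_int {σ : NNReal} (hσ : σ ≠ 0) (m : Fin n → ℝ) (h : (Fin n → ℝ) → ℝ) :
    ∫ y, h y ∂(nu σ m) = ∫ y, (∏ i, gaussianPDFReal (m i) (σ ^ 2) (y i)) * h y := by
  rw [nu_density hσ, integral_withDensity_eq_integral_toReal_smul (meas_dens σ m)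
    (ae_of_all _ fun _ => ENNReal.ofReal_lt_top)]
  refine integral_congr_ae (ae_of_all _ fun y => ?_)
  simp only [ENNReal.toReal_ofReal (dens_nonneg σ m y), smul_eq_mul]

lemma nu_integrable {σ : NNReal} (hσ : σ ≠ 0) (m : Fin n → ℝ) {h : (Fin n → ℝ) → ℝ}
    (hh : Integrable h (nu σ m)) :
    Integrable (fun y => (∏ i, gaussianPDFReal (m i) (σ ^ 2) (y i)) * h y) := by
  rw [nu_density hσ, integrable_withDensity_iff_integrable_smul' (meas_dens σ m)
    (ae_of_all _ fun _ => ENNReal.ofReal_lt_top)] at hh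
  refine hh.congr (ae_of_all _ fun y => ?_)
  simp only [ENNReal.toReal_ofReal (dens_nonneg σ m y), smul_eq_mul]

lemma dens_eq (σ : NNReal) (m : Fin n → ℝ) : ∃ c : ℝ,
    (fun y : Fin n → ℝ => ∏ i, gaussianPDFReal (m i) (σ ^ 2) (y i)) =
    fun y => c * Real.exp (∑ i, -(y i - m i) ^ 2 / (2 * (σ:ℝ) ^ 2)) := by
  refine ⟨∏ i : Fin n, (√(2 * Real.pi * (σ:ℝ) ^ 2))⁻¹, ?_⟩
  ext y
  simp only [gaussianPDFReal, Finset.prod_mul_distrib, Real.exp_sum, NNReal.coe_pow]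

lemma dens_hasFDeriv {σ : NNReal} (hσ : σ ≠ 0) (m y : Fin n → ℝ) :
    DifferentiableAt ℝ (fun y : Fin n → ℝ => ∏ i, gaussianPDFReal (m i) (σ ^ 2) (y i)) y ∧
    ∀ i, fderiv ℝ (fun y : Fin n → ℝ => ∏ i, gaussianPDFReal (m i) (σ ^ 2) (y i)) y
      (Pi.single i 1) =
      (∏ i, gaussianPDFReal (m i) (σ ^ 2) (y i)) * (-(y i - m i) / (σ:ℝ) ^ 2) := by
  have hσ' : (σ:ℝ) ≠ 0 := by exact_mod_cast hσ
  obtain ⟨c, hc⟩ := dens_eq σ m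
  have hcy := congrFun hc y
  have hd : ∀ j : Fin n, HasFDerivAt (fun y : Fin n → ℝ => -(y j - m j) ^ 2 / (2 * (σ:ℝ) ^ 2))
     ((-(y j - m j) / (σ:ℝ)^2) • ContinuousLinearMap.proj (R := ℝ) (φ := fun _ : Fin n => ℝ) j) y := by
    intro j
    have h1 : HasFDerivAt (fun y : Fin n → ℝ => y j - m j)
      (ContinuousLinearMap.proj (R := ℝ) (φ := fun _ : Fin n => ℝ) j) y :=
      (ContinuousLinearMap.proj (R := ℝ) (φ := fun _ : Fin n => ℝ) j).hasFDerivAt.sub_const _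
    have h2 : HasDerivAt (fun t : ℝ => - t ^ 2 / (2 * (σ:ℝ) ^ 2))
        (-(y j - m j) / (σ:ℝ)^2) (y j - m j) := by
      have := ((hasDerivAt_pow 2 (y j - m j)).neg).div_const (2 * (σ:ℝ)^2)
      have e : -(y j - m j) / (σ:ℝ)^2 = -(((2:ℕ):ℝ) * (y j - m j) ^ (2 - 1)) / (2 * (σ:ℝ) ^ 2) := by
        push_cast
        field_simp
      rw [e]
      exact this
    exact h2.comp_hasFDerivAt y h1
  have hs := ((HasFDerivAt.fun_sum (u := Finset.univ) fun j _ => hd j).exp).const_mul c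
  rw [hc]
  refine ⟨hs.differentiableAt, fun i => ?_⟩
  rw [hs.fderiv, hcy]
  simp [Pi.single_apply]
  ring

lemma stein (σ : NNReal) (m : Fin n → ℝ) (i : Fin n) {h : (Fin n → ℝ) → ℝ}
    (hh : h.HasTemperateGrowth) :
    ∫ y, (y i - m i) * h y ∂(nu σ m) = (σ:ℝ) ^ 2 * ∫ y, pd i h y ∂(nu σ m) := by
  by_cases hσ : σ = 0
  · subst hσ
    have h1 : (fun y : Fin n → ℝ => (y i - m i) * h y) =ᵐ[nu 0 m] 0 := by
      have h2 : ∀ᵐ x ∂(gaussianReal (m i) (0 ^ 2)), x = m i := by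
        simp [ae_dirac_eq]
      have h3 := (measurePreserving_eval (fun i => gaussianReal (m i) ((0:NNReal) ^ 2)) i).quasiMeasurePreserving.ae h2
      filter_upwards [h3] with y hy
      simp only [Function.eval] at hy
      simp [hy]
    rw [integral_congr_ae h1]
    simp
  have hσ' : (σ:ℝ) ≠ 0 := by exact_mod_cast hσ
  rw [nu_int hσ, nu_int hσ]
  have hip := integral_mul_fderiv_eq_neg_fderiv_mul_of_integrable (μ := (volume : Measure (Fin n → ℝ)))
    (f := fun y : Fin n → ℝ => ∏ i, gaussianPDFReal (m i) (σ ^ 2) (y i)) (g := h)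
    (v := Pi.single i 1) ?_ ?_ ?_ (fun y _ => (dens_hasFDeriv hσ m y).1) (fun y _ => htg_diff hh y)
  · show _ = (σ:ℝ)^2 * ∫ y, _ * fderiv ℝ h y (Pi.single i 1)
    rw [hip, ← integral_neg, ← integral_const_mul]
    refine integral_congr_ae (ae_of_all _ fun y => ?_)
    simp only [(dens_hasFDeriv hσ m y).2 i]
    field_simp
  · have := nu_integrable hσ m (htg_int σ m (h := fun y => (-(σ:ℝ)^2)⁻¹ * ((y i - m i) * h y)) (by fun_prop))
    refine this.congr (ae_of_all _ fun y => ?_)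
    simp only [(dens_hasFDeriv hσ m y).2 i]
    field_simp
  · exact nu_integrable hσ m (htg_int σ m (htg_pd i hh))
  · exact nu_integrable hσ m (htg_int σ m hh)


lemma stein2 (σ : NNReal) (m : Fin n → ℝ) {g : Fin n → (Fin n → ℝ) → ℝ}
    (hg : ∀ i, (g i).HasTemperateGrowth) :
    ∫ y, (∑ i, (y i - m i) * g i y - (σ:ℝ) ^ 2 * ∑ i, pd i (g i) y) ^ 2 ∂(nu σ m) =
      (σ:ℝ) ^ 2 * (∑ i, ∫ y, g i y ^ 2 ∂(nu σ m)) +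
      (σ:ℝ) ^ 4 * ∑ i, ∑ j, ∫ y, pd j (g i) y * pd i (g j) y ∂(nu σ m) := by
  have hI : ∀ {h : (Fin n → ℝ) → ℝ}, h.HasTemperateGrowth → Integrable h (nu σ m) :=
    fun hh => htg_int σ m hh
  obtain ⟨S, hSdef⟩ : ∃ S : (Fin n → ℝ) → ℝ, S = fun y => ∑ i, (y i - m i) * g i y -
    (σ:ℝ) ^ 2 * ∑ i, pd i (g i) y := ⟨_, rfl⟩
  have hS : S.HasTemperateGrowth := by rw [hSdef]; fun_prop
  have hpS : ∀ i y, pd i S y = g i y + ∑ j, ((y j - m j) * pd i (g j) y) -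
      (σ:ℝ) ^ 2 * ∑ j, pd j (pd i (g j)) y := by
    intro i y
    rw [hSdef, pd_sub i (by fun_prop) (by fun_prop), pd_const_mul i _ (by fun_prop),
      pd_sum i (fun j => by fun_prop), pd_sum i (fun j => by fun_prop)]
    congr 1
    · rw [← Fintype.sum_ite_eq i (fun j => g j y), ← Finset.sum_add_distrib]
      refine Finset.sum_congr rfl fun j _ => ?_
      rw [pd_mul i (by fun_prop) (hg j), pd_coord]
      simp
    · congr 1
      exact Finset.sum_congr rfl fun j _ => pd_comm i j (hg j) y
  have e1 : ∫ y, (∑ i, (y i - m i) * g i y - (σ:ℝ) ^ 2 * ∑ i, pd i (g i) y) ^ 2 ∂(nu σ m) =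
      ∑ i, ∫ y, (y i - m i) * (g i y * S y) ∂(nu σ m) -
        (σ:ℝ) ^ 2 * ∑ i, ∫ y, pd i (g i) y * S y ∂(nu σ m) := by
    rw [← integral_finsetSum _ (fun i _ => hI (by fun_prop)),
      ← integral_finsetSum _ (fun i _ => hI (by fun_prop)), ← integral_const_mul,
      ← integral_sub (hI (by fun_prop)) (hI (by fun_prop))]
    refine integral_congr_ae (ae_of_all _ fun y => ?_)
    simp only
    have : S y = ∑ i, (y i - m i) * g i y - (σ:ℝ) ^ 2 * ∑ i, pd i (g i) y := by rw [hSdef]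
    simp only [← mul_assoc, ← Finset.sum_mul]
    rw [← this, mul_assoc, ← mul_assoc, ← sub_mul, ← this, sq]
  have e2 : ∀ i, ∫ y, (y i - m i) * (g i y * S y) ∂(nu σ m) =
      (σ:ℝ) ^ 2 * (∫ y, pd i (g i) y * S y ∂(nu σ m) + ∫ y, g i y * pd i S y ∂(nu σ m)) := by
    intro i
    rw [stein σ m i (by fun_prop), ← integral_add (hI (by fun_prop)) (hI (by fun_prop))]
    congr 1
    exact integral_congr_ae (ae_of_all _ fun y => pd_mul i (hg i) hS y)
  have e4 : ∀ i j, ∫ y, (y j - m j) * (g i y * pd i (g j) y) ∂(nu σ m) =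
      (σ:ℝ) ^ 2 * (∫ y, pd j (g i) y * pd i (g j) y ∂(nu σ m) +
        ∫ y, g i y * pd j (pd i (g j)) y ∂(nu σ m)) := by
    intro i j
    rw [stein σ m j (by fun_prop), ← integral_add (hI (by fun_prop)) (hI (by fun_prop))]
    congr 1
    exact integral_congr_ae (ae_of_all _ fun y => pd_mul j (hg i) (htg_pd i (hg j)) y)
  have e3 : ∀ i, ∫ y, g i y * pd i S y ∂(nu σ m) = ∫ y, g i y ^ 2 ∂(nu σ m) +
      (σ:ℝ) ^ 2 * ∑ j, ∫ y, pd j (g i) y * pd i (g j) y ∂(nu σ m) := by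
    intro i
    have : ∫ y, g i y * pd i S y ∂(nu σ m) = ∫ y, g i y ^ 2 ∂(nu σ m) +
      ∑ j, ∫ y, (y j - m j) * (g i y * pd i (g j) y) ∂(nu σ m) -
      (σ:ℝ) ^ 2 * ∑ j, ∫ y, g i y * pd j (pd i (g j)) y ∂(nu σ m) := by
      rw [← integral_finsetSum _ (fun i _ => hI (by fun_prop)),
        ← integral_finsetSum _ (fun i _ => hI (by fun_prop)), ← integral_const_mul,
        ← integral_add (hI (by fun_prop)) (hI (by fun_prop)),
        ← integral_sub (hI (by fun_prop)) (hI (by fun_prop))]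
      refine integral_congr_ae (ae_of_all _ fun y => ?_)
      simp only [hpS, mul_sub, mul_add, Finset.mul_sum]
      congr 1
      · congr 1
        · ring
        · exact Finset.sum_congr rfl fun j _ => by ring
      · exact Finset.sum_congr rfl fun j _ => by ring
    rw [this]
    simp only [e4, mul_add, Finset.sum_add_distrib, Finset.mul_sum]
    ring
  rw [e1]
  simp only [e2, e3, mul_add, Finset.sum_add_distrib, ← Finset.mul_sum]
  ring

end

theorem sure_for_sure (n : ℕ) (σ : NNReal) (μv : Fin n → ℝ)
    (muhat : (Fin n → ℝ) → (Fin n → ℝ))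
    (hm : ContDiff ℝ (⊤ : ℕ∞) muhat) (hmsupp : HasCompactSupport muhat) :
    let ν : Measure (Fin n → ℝ) := Measure.pi fun i : Fin n => gaussianReal (μv i) (σ ^ 2)
    let SURE : (Fin n → ℝ) → ℝ := fun y =>
      (∑ i, (y i - muhat y i) ^ 2) +
        2 * (σ : ℝ) ^ 2 * (∑ i, fderiv ℝ (fun x => muhat x i) y (Pi.single i 1)) -
        (σ : ℝ) ^ 2 * n
    (∫ y, (SURE y - ∑ i, (muhat y i - μv i) ^ 2) ^ 2 ∂ν) =
      ∫ y, (4 * (σ : ℝ) ^ 2 * (∑ i, (y i - muhat y i) ^ 2) +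
          4 * (σ : ℝ) ^ 4 * (∑ i, ∑ j, fderiv ℝ (fun x => muhat x i) y (Pi.single j 1) *
            fderiv ℝ (fun x => muhat x j) y (Pi.single i 1)) -
          2 * (σ : ℝ) ^ 4 * n) ∂ν := by
  intro ν SURE
  have hν : ν = nu σ μv := rfl
  have hmt : muhat.HasTemperateGrowth := hmsupp.hasTemperateGrowth hm
  obtain ⟨M, hMdef⟩ : ∃ M : Fin n → (Fin n → ℝ) → ℝ, M = fun i x => muhat x i := ⟨_, rfl⟩
  have hM : ∀ i, (M i).HasTemperateGrowth := by
    intro i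
    rw [hMdef]
    exact (htg_coord i).comp hmt
  have hMy : ∀ i y, muhat y i = M i y := by intro i y; rw [hMdef]
  have hpM : ∀ i j y, fderiv ℝ (fun x => muhat x i) y (Pi.single j 1) = pd j (M i) y := by
    intro i j y; rw [hMdef]; rfl
  simp only [SURE, hpM, hν]
  simp only [hMy]
  clear_value ν
  have hI : ∀ {h : (Fin n → ℝ) → ℝ}, h.HasTemperateGrowth → Integrable h (nu σ μv) :=
    fun hh => htg_int σ μv hh
  obtain ⟨g, hgdef⟩ : ∃ g : Fin n → (Fin n → ℝ) → ℝ,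
    g = fun i y => ((1/2) * (y i - μv i) - (M i y - μv i)) := ⟨_, rfl⟩
  have hg : ∀ i, (g i).HasTemperateGrowth := by intro i; rw [hgdef]; fun_prop
  have hpg : ∀ i j y, pd j (g i) y = (if j = i then 1/2 else 0) - pd j (M i) y := by
    intro i j y
    have hc : pd j (fun y => M i y - μv i) y = pd j (M i) y := by
      unfold pd; rw [fderiv_sub_const]
    rw [hgdef, pd_sub j (by fun_prop) (by fun_prop), pd_const_mul j _ (by fun_prop), pd_coord, hc]
    simp
  have hn : ∑ i : Fin n, (1:ℝ) = n := by simp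
  have key := stein2 σ μv hg
  have hL : ∫ y, (∑ i, (y i - M i y) ^ 2 + 2 * (σ:ℝ) ^ 2 * ∑ i, pd i (M i) y - (σ:ℝ) ^ 2 * n -
      ∑ i, (M i y - μv i) ^ 2) ^ 2 ∂(nu σ μv) =
      4 * ∫ y, (∑ i, (y i - μv i) * g i y - (σ:ℝ) ^ 2 * ∑ i, pd i (g i) y) ^ 2 ∂(nu σ μv) := by
    rw [← integral_const_mul]
    refine integral_congr_ae (ae_of_all _ fun y => ?_)
    have : ∑ i, (y i - M i y) ^ 2 + 2 * (σ:ℝ) ^ 2 * ∑ i, pd i (M i) y - (σ:ℝ) ^ 2 * n -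
      ∑ i, (M i y - μv i) ^ 2 =
      2 * (∑ i, (y i - μv i) * g i y - (σ:ℝ) ^ 2 * ∑ i, pd i (g i) y) := by
      rw [← hn]
      simp only [hpg, Finset.mul_sum, ← Finset.sum_sub_distrib, ← Finset.sum_add_distrib]
      refine Finset.sum_congr rfl fun i _ => ?_
      rw [hgdef]
      simp
      ring
    simp only [this]
    ring
  rw [hL, key]
  -- first-order identities
  have s1 : ∀ i, ∫ y, (y i - μv i) * (y i - M i y) ∂(nu σ μv) =
      (σ:ℝ) ^ 2 * (1 - ∫ y, pd i (M i) y ∂(nu σ μv)) := by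
    intro i
    rw [stein σ μv i (by fun_prop)]
    congr 1
    have : ∀ y, pd i (fun y => y i - M i y) y = 1 - pd i (M i) y := by
      intro y
      rw [pd_sub i (by fun_prop) (by fun_prop)]
      have := pd_coord i i 0 y
      simp at this
      rw [this]
    simp only [this]
    rw [integral_sub (by simp) (hI (by fun_prop))]
    simp
  have s2 : ∀ i, ∫ y, (y i - μv i) ^ 2 ∂(nu σ μv) = (σ:ℝ) ^ 2 := by
    intro i
    simp only [sq (_ - _)]
    rw [stein σ μv i (by fun_prop)]
    simp [pd_coord]
  have g1 : ∀ i, ∫ y, g i y ^ 2 ∂(nu σ μv) = ∫ y, (y i - M i y) ^ 2 ∂(nu σ μv) -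
      (σ:ℝ) ^ 2 * (1 - ∫ y, pd i (M i) y ∂(nu σ μv)) + (1/4) * (σ:ℝ) ^ 2 := by
    intro i
    rw [← s1 i, ← s2 i, ← integral_const_mul, ← integral_sub (hI (by fun_prop)) (hI (by fun_prop)),
      ← integral_add (hI (by fun_prop)) (hI (by fun_prop))]
    refine integral_congr_ae (ae_of_all _ fun y => ?_)
    rw [hgdef]
    simp only
    ring
  have g2 : ∀ i, ∑ j, ∫ y, pd j (g i) y * pd i (g j) y ∂(nu σ μv) =
      ∑ j, ∫ y, pd j (M i) y * pd i (M j) y ∂(nu σ μv) + 1/4 -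
        ∫ y, pd i (M i) y ∂(nu σ μv) := by
    intro i
    have : ∀ j, ∫ y, pd j (g i) y * pd i (g j) y ∂(nu σ μv) =
      ∫ y, pd j (M i) y * pd i (M j) y ∂(nu σ μv) +
        if i = j then (1/4 - ∫ y, pd i (M i) y ∂(nu σ μv)) else 0 := by
      intro j
      by_cases hij : i = j
      · subst hij
        have hc : ∫ y : Fin n → ℝ, (1/4 : ℝ) ∂(nu σ μv) = 1/4 := by simp
        simp only [if_true]
        rw [← hc]
        rw [← integral_sub (by fun_prop) (hI (by fun_prop)),
          ← integral_add (hI (by fun_prop)) (hI (by fun_prop))]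
        refine integral_congr_ae (ae_of_all _ fun y => ?_)
        simp only [hpg, if_true]
        ring
      · simp [hpg, hij, Ne.symm hij]
    simp only [this, Finset.sum_add_distrib, Fintype.sum_ite_eq]
    ring
  rw [integral_sub (hI (by fun_prop)) (by fun_prop), integral_add (hI (by fun_prop)) (hI (by fun_prop)),
    integral_const_mul, integral_const_mul, integral_finsetSum _ (fun i _ => hI (by fun_prop)),
    integral_finsetSum _ (fun i _ => hI (by fun_prop))]
  have hs : ∀ i, ∫ y, ∑ j, pd j (M i) y * pd i (M j) y ∂(nu σ μv) =
    ∑ j, ∫ y, pd j (M i) y * pd i (M j) y ∂(nu σ μv) := fun i =>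
      integral_finsetSum _ (fun j _ => hI (by fun_prop))
  obtain ⟨T, hT⟩ : ∃ T : Fin n → ℝ, ∀ i,
    ∑ j, ∫ y, pd j (M i) y * pd i (M j) y ∂(nu σ μv) = T i := ⟨_, fun _ => rfl⟩
  simp only [g1, g2, hs, hT, integral_const, probReal_univ, one_smul]
  rw [← hn]
  simp only [Finset.mul_sum, ← Finset.sum_sub_distrib, ← Finset.sum_add_distrib]
  refine Finset.sum_congr rfl fun i _ => ?_
  ring
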